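/- Let C be a left-cancellative category that is Noetherian (both left- and right-Noetherian), in which any two morphisms with the same source that admit a common right-multiple admit a right-lcm, and whose only invertible morphisms are the identity morphisms. Then the intersection of all Garside families of C is itself a Garside family; in particular, C possesses a smallest Garside family (one contained in every Garside family of C). -/

import Mathlib

open CategoryTheory

universe u v

namespace GarsideTest

variable {C : Type u} [Category.{v} C]

/-- `C` is left-cancellative. -/
def LeftCancellative (C : Type u) [Category.{v} C] : Prop :=
  ∀ ⦃x y z : C⦄ (f : x ⟶ y) (g g' : y ⟶ z), f ≫ g = f ≫ g' → g = g'

/-- `f` left-divides `g`. -/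
def LDiv {x y z : C} (f : x ⟶ y) (g : x ⟶ z) : Prop :=
  ∃ r : y ⟶ z, f ≫ r = g

/-- `f` properly left-divides `g` (`f ⊏ g`). -/
def LDivStrict {x y z : C} (f : x ⟶ y) (g : x ⟶ z) : Prop :=
  LDiv f g ∧ ¬ LDiv g f

/-- `f =× g` : `g` is obtained from `f` by right-multiplication by an invertible element. -/
def EqIr {x y z : C} (f : x ⟶ y) (g : x ⟶ z) : Prop :=
  ∃ e : y ⟶ z, IsIso e ∧ f ≫ e = g

/-- The family `S♯ = S C× ∪ C×`. -/
def Sharp (S : MorphismProperty C) : MorphismProperty C :=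
  fun x z g =>
    (∃ (y : C) (s : x ⟶ y) (e : y ⟶ z), S s ∧ IsIso e ∧ s ≫ e = g) ∨ IsIso g

/-- Composable paths of morphisms of `C`. -/
inductive Path {C : Type u} [Category.{v} C] : C → C → Type (max u v)
  | nil (x : C) : Path x x
  | cons {x y z : C} (g : x ⟶ y) (p : Path y z) : Path x z

namespace Path

/-- The composite of a path. -/
def comp : ∀ {x z : C}, Path x z → (x ⟶ z)
  | _, _, nil x => 𝟙 x
  | _, _, cons g p => g ≫ p.comp

/-- The length of a path. -/
def length : ∀ {x z : C}, Path x z → ℕ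
  | _, _, nil _ => 0
  | _, _, cons _ p => p.length + 1

/-- All entries of the path lie in `T`. -/
def Entries (T : MorphismProperty C) : ∀ {x z : C}, Path x z → Prop
  | _, _, nil _ => True
  | _, _, cons g p => T g ∧ Entries T p

/-- Concatenation of paths. -/
def append : ∀ {x y z : C}, Path x y → Path y z → Path x z
  | _, _, _, nil _, q => q
  | _, _, _, cons g p, q => cons g (p.append q)

open scoped Classical in
/-- Number of non-invertible entries of a path. -/
noncomputable def ninv : ∀ {x z : C}, Path x z → ℕ
  | _, _, nil _ => 0
  | _, _, cons g p => (if IsIso g then 0 else 1) + p.ninv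

end Path

/-- The length-two path `(g₁, g₂)` is `S`-greedy. -/
def Greedy2 (S : MorphismProperty C) {x y z : C} (g₁ : x ⟶ y) (g₂ : y ⟶ z) : Prop :=
  ∀ ⦃u w : C⦄ (f : u ⟶ x) (h : u ⟶ w), S h → LDiv h (f ≫ g₁ ≫ g₂) → LDiv h (f ≫ g₁)

/-- Auxiliary: the path `g :: p` is `S`-greedy. -/
def Path.GreedyFrom (S : MorphismProperty C) : ∀ {x y z : C}, (x ⟶ y) → Path y z → Prop
  | _, _, _, _, .nil _ => True
  | _, _, _, g, .cons g' p => Greedy2 S g g' ∧ Path.GreedyFrom S g' p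

/-- The path `p` is `S`-greedy. -/
def Path.Greedy (S : MorphismProperty C) : ∀ {x z : C}, Path x z → Prop
  | _, _, .nil _ => True
  | _, _, .cons g p => Path.GreedyFrom S g p

/-- The path `p` is `S`-normal: `S`-greedy with entries in `S♯`. -/
def Path.Normal (S : MorphismProperty C) {x z : C} (p : Path x z) : Prop :=
  p.Greedy S ∧ p.Entries (Sharp S)

/-- `p` is an `S`-normal decomposition of the morphism `g`. -/
def IsNormalDecomp (S : MorphismProperty C) {x z : C} (g : x ⟶ z) (p : Path x z) : Prop :=
  p.Normal S ∧ p.comp = g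

/-- `X` generates `C`. -/
def Generates (X : MorphismProperty C) : Prop :=
  ∀ ⦃x z : C⦄ (g : x ⟶ z), ∃ p : Path x z, p.Entries X ∧ p.comp = g

/-- `S` is a Garside family in `C`. -/
def IsGarside (S : MorphismProperty C) : Prop :=
  ∀ ⦃x z : C⦄ (g : x ⟶ z), ∃ p : Path x z, IsNormalDecomp S g p

/-- `Xʳ`: morphisms expressible as composites of `r` elements of `X`. -/
def MPow (X : MorphismProperty C) (r : ℕ) : MorphismProperty C :=
  fun x z g => ∃ p : Path x z, p.Entries X ∧ p.length = r ∧ p.comp = g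

/-- `X` is closed under right-complement. -/
def ClosedUnderRightComplement (X : MorphismProperty C) : Prop :=
  ∀ ⦃x y y' z : C⦄ (f : x ⟶ y) (g : x ⟶ y') (h : x ⟶ z), X f → X g →
    LDiv f h → LDiv g h →
    ∃ (w : C) (g' : y ⟶ w) (f' : y' ⟶ w),
      X g' ∧ X f' ∧ f ≫ g' = g ≫ f' ∧ LDiv (f ≫ g') h

/-- `X` is closed under right-comultiple. -/
def ClosedUnderRightComultiple (X : MorphismProperty C) : Prop :=
  ∀ ⦃x y y' z : C⦄ (f : x ⟶ y) (g : x ⟶ y') (h : x ⟶ z), X f → X g →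
    LDiv f h → LDiv g h →
    ∃ (w : C) (h' : x ⟶ w), X h' ∧ LDiv f h' ∧ LDiv g h' ∧ LDiv h' h

/-- `X` is closed under right-divisor. -/
def ClosedUnderRightDivisor (X : MorphismProperty C) : Prop :=
  ∀ ⦃x y z : C⦄ (f : x ⟶ y) (g : y ⟶ z), X (f ≫ g) → X g

/-- `g₁` is an `S`-head of `g`. -/
def IsHead (S : MorphismProperty C) {x w y : C} (g₁ : x ⟶ w) (g : x ⟶ y) : Prop :=
  S g₁ ∧ LDiv g₁ g ∧ ∀ ⦃w' : C⦄ (h : x ⟶ w'), S h → LDiv h g → LDiv h g₁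

/-- `h` is a right-lcm of `f` and `g`. -/
def IsRightLcm {x y y' w : C} (f : x ⟶ y) (g : x ⟶ y') (h : x ⟶ w) : Prop :=
  LDiv f h ∧ LDiv g h ∧ ∀ ⦃w' : C⦄ (h' : x ⟶ w'), LDiv f h' → LDiv g h' → LDiv h h'

/-- `X` is closed under right-lcm. -/
def ClosedUnderRightLcm (X : MorphismProperty C) : Prop :=
  ∀ ⦃x y y' w : C⦄ (f : x ⟶ y) (g : x ⟶ y') (h : x ⟶ w), X f → X g →
    IsRightLcm f g h → X h

/-- `C` is right-Noetherian: proper right-divisibility is well-founded. -/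
def RightNoetherian (C : Type u) [Category.{v} C] : Prop :=
  WellFounded (fun a b : Σ (x : C) (y : C), x ⟶ y =>
    ∃ (e : a.2.1 = b.2.1) (g' : b.1 ⟶ a.1), ¬ IsIso g' ∧ g' ≫ a.2.2 ≫ eqToHom e = b.2.2)

/-- `C` is left-Noetherian: proper left-divisibility is well-founded. -/
def LeftNoetherian (C : Type u) [Category.{v} C] : Prop :=
  WellFounded (fun a b : Σ (x : C) (y : C), x ⟶ y =>
    ∃ (e : b.1 = a.1) (g' : a.2.1 ⟶ b.2.1), ¬ IsIso g' ∧ eqToHom e ≫ a.2.2 ≫ g' = b.2.2)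

/-- `g` is an atom of `C`. -/
def IsAtomMor {x y : C} (g : x ⟶ y) : Prop :=
  ¬ IsIso g ∧ ∀ ⦃w : C⦄ (f : x ⟶ w) (h : w ⟶ y), f ≫ h = g → IsIso f ∨ IsIso h

/-- The only invertible morphisms of `C` are identities. -/
def NoNontrivialInvertible (C : Type u) [Category.{v} C] : Prop :=
  ∀ ⦃x y : C⦄ (e : x ⟶ y), IsIso e → ∃ h : x = y, e = eqToHom h

/-- Deformation by invertible elements, with a connecting morphism `e` at the left end. -/
inductive DeformRel : ∀ {xf xg z : C}, (xf ⟶ xg) → Path xf z → Path xg z → Prop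
  | nil (z : C) : DeformRel (𝟙 z) (.nil z) (.nil z)
  | cons {xf xg yf yg z : C} (e : xf ⟶ xg) (f : xf ⟶ yf) (g : xg ⟶ yg) (e' : yf ⟶ yg)
      {p : Path yf z} {q : Path yg z} :
      IsIso e' → e ≫ g = f ≫ e' → DeformRel e' p q →
      DeformRel e (.cons f p) (.cons g q)
  | padF {xg yg z : C} (e : z ⟶ xg) (g : xg ⟶ yg) (e' : z ⟶ yg) {q : Path yg z} :
      IsIso e' → e ≫ g = e' → DeformRel e' (.nil z) q →
      DeformRel e (.nil z) (.cons g q)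
  | padG {xf yf z : C} (e : xf ⟶ z) (f : xf ⟶ yf) (e' : yf ⟶ z) {p : Path yf z} :
      IsIso e' → e = f ≫ e' → DeformRel e' p (.nil z) →
      DeformRel e (.cons f p) (.nil z)

/-- `p` is a `C×`-deformation of `q`. -/
def IsDeformation {x z : C} (p q : Path x z) : Prop :=
  DeformRel (𝟙 x) p q

lemma LDiv.trans {x y z w : C} {f : x ⟶ y} {g : x ⟶ z} {h : x ⟶ w}
    (hfg : LDiv f g) (hgh : LDiv g h) : LDiv f h := by
  obtain ⟨r, rfl⟩ := hfg
  obtain ⟨s, rfl⟩ := hgh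
  exact ⟨r ≫ s, by simp⟩

lemma LDiv.of_isIso {x y z : C} (f : x ⟶ y) [IsIso f] (g : x ⟶ z) : LDiv f g :=
  ⟨inv f ≫ g, by simp⟩

lemma LDiv.comp_left {x' x y z : C} (k : x' ⟶ x) {f : x ⟶ y} {g : x ⟶ z} (h : LDiv f g) :
    LDiv (k ≫ f) (k ≫ g) := by
  obtain ⟨r, rfl⟩ := h
  exact ⟨r, by simp⟩

lemma LDiv.cancel_left (hC : LeftCancellative C) {x' x y z : C} {k : x' ⟶ x} {f : x ⟶ y}
    {g : x ⟶ z} (h : LDiv (k ≫ f) (k ≫ g)) : LDiv f g := by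
  obtain ⟨r, hr⟩ := h
  exact ⟨r, hC k _ _ (by simpa using hr)⟩

lemma LeftCancellative.isIso_of_comp_eq_id (hC : LeftCancellative C) {x y : C} {f : x ⟶ y}
    {g : y ⟶ x} (h : f ≫ g = 𝟙 x) : IsIso f :=
  ⟨g, h, hC f _ _ (by rw [← Category.assoc, h]; simp)⟩

lemma LeftCancellative.isIso_of_lDiv (hC : LeftCancellative C) {x y z : C} {f : x ⟶ y}
    {g : y ⟶ z} (h : LDiv (f ≫ g) f) : IsIso g := by
  obtain ⟨r, hr⟩ := h
  exact hC.isIso_of_comp_eq_id (hC f (g ≫ r) (𝟙 _) (by simpa using hr))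

lemma Sharp.of_isIso (S : MorphismProperty C) {x y : C} (f : x ⟶ y) [h : IsIso f] : Sharp S f :=
  Or.inr h

lemma Sharp.of_mem {S : MorphismProperty C} {x y : C} {f : x ⟶ y} (h : S f) : Sharp S f :=
  Or.inl ⟨y, f, 𝟙 y, h, inferInstance, by simp⟩

lemma Sharp.comp_isIso {S : MorphismProperty C} {x y z : C} {f : x ⟶ y} (h : Sharp S f)
    (e : y ⟶ z) [IsIso e] : Sharp S (f ≫ e) := by
  rcases h with ⟨w, s, e', hs, he', rfl⟩ | h
  · exact Or.inl ⟨w, s, e' ≫ e, hs, inferInstance, by simp⟩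
  · exact Or.inr inferInstance

lemma NoNontrivialInvertible.sharp_iff (hinv : NoNontrivialInvertible C)
    {S : MorphismProperty C} {x y : C} {f : x ⟶ y} : Sharp S f ↔ S f ∨ IsIso f := by
  constructor
  · rintro (⟨w, s, e, hs, he, rfl⟩ | h)
    · obtain ⟨rfl, rfl⟩ := hinv e he
      exact Or.inl (by simpa using hs)
    · exact Or.inr h
  · rintro (h | h)
    exacts [Sharp.of_mem h, Sharp.of_isIso S f]

lemma Greedy2.sharp {S : MorphismProperty C} {x y z : C} {g₁ : x ⟶ y} {g₂ : y ⟶ z}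
    (hg : Greedy2 S g₁ g₂) : Greedy2 (Sharp S) g₁ g₂ := by
  rintro u w f h (⟨v, s, e, hs, he, rfl⟩ | hh) hd
  · obtain ⟨r, hr⟩ := hg f s hs (LDiv.trans ⟨e, rfl⟩ hd)
    exact ⟨inv e ≫ r, by simpa using hr⟩
  · exact LDiv.of_isIso _ _

lemma Path.GreedyFrom.greedy2_comp {S : MorphismProperty C} {x y z : C} {g : x ⟶ y}
    {p : Path y z} (hp : p.GreedyFrom S g) : Greedy2 S g p.comp := by
  induction p generalizing x with
  | nil => intro u w f h _ hd; simpa [Path.comp] using hd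
  | cons g' p ih =>
    intro u w f h hh hd
    refine hp.1 f h hh ?_
    simpa using ih hp.2 (f ≫ g) h hh (by simpa [Path.comp] using hd)

/-- In a Garside family, the first entry of a normal decomposition absorbs every left-divisor
in `Sharp S`, even after multiplication on the left. -/
lemma IsGarside.exists_greedy {S : MorphismProperty C} (hS : IsGarside S) {x z : C} (g : x ⟶ z) :
    ∃ (y : C) (s : x ⟶ y) (r : y ⟶ z), Sharp S s ∧ Greedy2 (Sharp S) s r ∧ s ≫ r = g := by
  obtain ⟨p, ⟨hgr, hent⟩, rfl⟩ := hS g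
  cases p with
  | nil =>
    exact ⟨x, 𝟙 x, 𝟙 x, Sharp.of_isIso S _, fun u w f h _ hd => by simpa using hd,
      by simp [Path.comp]⟩
  | cons s p => exact ⟨_, s, p.comp, hent.1, (Path.GreedyFrom.greedy2_comp hgr).sharp, rfl⟩

lemma IsGarside.closedUnderRightDivisor (hC : LeftCancellative C) {S : MorphismProperty C}
    (hS : IsGarside S) : ClosedUnderRightDivisor (Sharp S) := by
  intro x y z f g hfg
  obtain ⟨w, s, r, hs, hgr, rfl⟩ := hS.exists_greedy g
  have hd : LDiv (f ≫ s ≫ r) (f ≫ s) := hgr f _ hfg ⟨𝟙 _, by simp⟩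
  have : IsIso r := hC.isIso_of_lDiv (hd.cancel_left hC)
  exact hs.comp_isIso r

lemma IsGarside.closedUnderRightLcm (hC : LeftCancellative C) {S : MorphismProperty C}
    (hS : IsGarside S) : ClosedUnderRightLcm (Sharp S) := by
  rintro x y y' w f g h hf hg ⟨hfh, hgh, hmin⟩
  obtain ⟨v, s, r, hs, hgr, rfl⟩ := hS.exists_greedy h
  have absorb : ∀ {t : C} (k : x ⟶ t), Sharp S k → LDiv k (s ≫ r) → LDiv k s :=
    fun k hk hd => by simpa using hgr (𝟙 x) k hk (by simpa using hd)
  have : IsIso r := hC.isIso_of_lDiv (hmin s (absorb f hf hfh) (absorb g hg hgh))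
  exact hs.comp_isIso r

lemma Path.exists_lDiv_of_not_isIso {X : MorphismProperty C} {x z : C} (p : Path x z)
    (hp : p.Entries X) (hiso : ¬ IsIso p.comp) :
    ∃ (y y' : C) (e : x ⟶ y) (s : y ⟶ y') (r : y' ⟶ z),
      IsIso e ∧ X s ∧ ¬ IsIso s ∧ e ≫ s ≫ r = p.comp := by
  induction p with
  | nil => exact absurd (by simp only [Path.comp]; infer_instance) hiso
  | @cons x y z g p ih =>
    by_cases hg : IsIso g
    · obtain ⟨v, v', e, s, r, he, hs, hs', h⟩ := ih hp.2 (fun h => hiso (by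
        simp only [Path.comp]; infer_instance))
      exact ⟨v, v', g ≫ e, s, r, inferInstance, hs, hs', by simp [Path.comp, h]⟩
    · exact ⟨x, y, 𝟙 x, g, p.comp, inferInstance, hp.1, hg, by simp [Path.comp]⟩

lemma Generates.exists_lDiv (hinv : NoNontrivialInvertible C) {X : MorphismProperty C}
    (hX : Generates X) {x z : C} (g : x ⟶ z) (hg : ¬ IsIso g) :
    ∃ (y : C) (s : x ⟶ y), X s ∧ ¬ IsIso s ∧ LDiv s g := by
  obtain ⟨p, hp, rfl⟩ := hX g
  obtain ⟨v, v', e, s, r, he, hs, hs', h⟩ := p.exists_lDiv_of_not_isIso hp hg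
  obtain ⟨rfl, rfl⟩ := hinv e he
  exact ⟨v', s, hs, hs', r, by simpa using h⟩

lemma IsGarside.sharp_of_isAtomMor (hinv : NoNontrivialInvertible C) {S : MorphismProperty C}
    (hS : IsGarside S) {x y : C} {g : x ⟶ y} (hg : IsAtomMor g) : Sharp S g := by
  have hgen : Generates (Sharp S) := fun x z g => by
    obtain ⟨p, hp, h⟩ := hS g
    exact ⟨p, hp.2, h⟩
  obtain ⟨w, s, hs, hs', r, rfl⟩ := hgen.exists_lDiv hinv g hg.1
  have : IsIso r := (hg.2 s r rfl).resolve_left hs'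
  exact hs.comp_isIso r

lemma LeftNoetherian.exists_isAtomMor (hLN : LeftNoetherian C) {x z : C} (g : x ⟶ z)
    (hg : ¬ IsIso g) : ∃ (y : C) (a : x ⟶ y), IsAtomMor a ∧ LDiv a g := by
  suffices H : ∀ m : (Σ (x : C) (y : C), x ⟶ y), ¬ IsIso m.2.2 →
      ∃ (y : C) (a : m.1 ⟶ y), IsAtomMor a ∧ LDiv a m.2.2 from H ⟨x, z, g⟩ hg
  intro m
  induction m using hLN.induction with
  | h m ih =>
    obtain ⟨x, z, g⟩ := m
    intro hg
    by_cases ha : IsAtomMor g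
    · exact ⟨z, g, ha, 𝟙 z, by simp⟩
    · obtain ⟨w, f, h, rfl, hf, hh⟩ : ∃ (w : C) (f : x ⟶ w) (h : w ⟶ z),
          f ≫ h = g ∧ ¬ IsIso f ∧ ¬ IsIso h := by
        simpa [IsAtomMor, hg] using ha
      obtain ⟨y, a, ha, hd⟩ := ih ⟨x, w, f⟩ ⟨rfl, h, hh, by simp⟩ hf
      exact ⟨y, a, ha, hd.trans ⟨h, rfl⟩⟩

lemma generates_of_isAtomMor (hLN : LeftNoetherian C) (hRN : RightNoetherian C)
    {X : MorphismProperty C} (hiso : ∀ ⦃x y : C⦄ (f : x ⟶ y), IsIso f → X f)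
    (hatom : ∀ ⦃x y : C⦄ (f : x ⟶ y), IsAtomMor f → X f) : Generates X := by
  suffices H : ∀ m : (Σ (x : C) (y : C), x ⟶ y), ∃ p : Path m.1 m.2.1,
      p.Entries X ∧ p.comp = m.2.2 from fun x z g => H ⟨x, z, g⟩
  intro m
  induction m using hRN.induction with
  | h m ih =>
    obtain ⟨x, z, g⟩ := m
    by_cases hg : IsIso g
    · exact ⟨.cons g (.nil z), ⟨hiso g hg, trivial⟩, by simp [Path.comp]⟩
    · obtain ⟨y, a, ha, r, rfl⟩ := hLN.exists_isAtomMor g hg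
      obtain ⟨p, hp, hr⟩ := ih ⟨y, z, r⟩ ⟨rfl, a, ha.1, by simp⟩
      exact ⟨.cons a p, ⟨hatom a ha, hp⟩, by simp [Path.comp, hr]⟩

/-- Every morphism has a head in a family that contains the identities and is closed
under right-lcm. -/
lemma RightNoetherian.exists_isHead (hRN : RightNoetherian C) (hC : LeftCancellative C)
    (hlcm : ∀ ⦃x y y' : C⦄ (f : x ⟶ y) (g : x ⟶ y'),
      (∃ (w : C) (h : x ⟶ w), LDiv f h ∧ LDiv g h) →
      ∃ (w : C) (h : x ⟶ w), IsRightLcm f g h)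
    {X : MorphismProperty C} (hid : ∀ x : C, X (𝟙 x)) (hX : ClosedUnderRightLcm X)
    {x z : C} (g : x ⟶ z) : ∃ (y : C) (s : x ⟶ y), IsHead X s g := by
  obtain ⟨m, ⟨w, f, r, hf, hfr, rfl⟩, hmin⟩ := hRN.has_min
    {m : Σ (x : C) (y : C), x ⟶ y | ∃ (w : C) (f : x ⟶ w) (r : w ⟶ z),
      X f ∧ f ≫ r = g ∧ m = ⟨w, z, r⟩}
    ⟨_, x, 𝟙 x, g, hid x, by simp, rfl⟩
  refine ⟨w, f, hf, ⟨r, hfr⟩, fun w' h hh hd => ?_⟩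
  obtain ⟨v, l, hl⟩ := hlcm f h ⟨z, g, ⟨r, hfr⟩, hd⟩
  have hlX := hX f h l hf hh hl
  obtain ⟨⟨t, rfl⟩, hhl, hlmin⟩ := hl
  obtain ⟨r', hr'⟩ := hlmin g ⟨r, hfr⟩ hd
  have ht : IsIso t := by
    by_contra ht
    refine hmin ⟨v, z, r'⟩ ⟨v, f ≫ t, r', hlX, hr', rfl⟩ ⟨rfl, t, ht, ?_⟩
    exact hC f _ _ (by simpa [hfr] using hr')
  exact hhl.trans ⟨inv t, by simp⟩

/-- Left-divisibility by an element of a generating family closed under right-lcm and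
right-divisor can be pushed past any morphism `f`. -/
lemma exists_lDiv_comp (hC : LeftCancellative C)
    (hlcm : ∀ ⦃x y y' : C⦄ (f : x ⟶ y) (g : x ⟶ y'),
      (∃ (w : C) (h : x ⟶ w), LDiv f h ∧ LDiv g h) →
      ∃ (w : C) (h : x ⟶ w), IsRightLcm f g h)
    {X : MorphismProperty C} (hgen : Generates X) (hX : ClosedUnderRightLcm X)
    (hdiv : ClosedUnderRightDivisor X) {u x w z : C} (f : u ⟶ x) (h : u ⟶ w) (k : x ⟶ z)
    (hh : X h) (hd : LDiv h (f ≫ k)) :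
    ∃ (v : C) (h' : x ⟶ v), X h' ∧ LDiv h (f ≫ h') ∧ LDiv h' k := by
  obtain ⟨p, hp, rfl⟩ := hgen f
  induction p generalizing w with
  | nil => exact ⟨w, h, hh, ⟨𝟙 _, by simp [Path.comp]⟩, by simpa [Path.comp] using hd⟩
  | cons g p ih =>
    simp only [Path.comp, Category.assoc] at hd
    obtain ⟨v, l, hl⟩ := hlcm g h ⟨z, _, ⟨_, rfl⟩, hd⟩
    have hlX := hX g h l hp.1 hh hl
    obtain ⟨⟨t, rfl⟩, hhl, hlmin⟩ := hl
    have htd : LDiv t (p.comp ≫ k) := (hlmin _ ⟨_, rfl⟩ hd).cancel_left hC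
    obtain ⟨v', h', hh', hd', hk⟩ := ih t k (hdiv g t hlX) hp.2 htd
    exact ⟨v', h', hh', hhl.trans (by simpa [Path.comp] using hd'.comp_left g), hk⟩

theorem isGarside_of_closed (hC : LeftCancellative C) (hRN : RightNoetherian C)
    (hlcm : ∀ ⦃x y y' : C⦄ (f : x ⟶ y) (g : x ⟶ y'),
      (∃ (w : C) (h : x ⟶ w), LDiv f h ∧ LDiv g h) →
      ∃ (w : C) (h : x ⟶ w), IsRightLcm f g h)
    (hinv : NoNontrivialInvertible C) {S : MorphismProperty C} (hgen : Generates (Sharp S))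
    (hX : ClosedUnderRightLcm (Sharp S)) (hdiv : ClosedUnderRightDivisor (Sharp S)) :
    IsGarside S := by
  suffices H : ∀ m : (Σ (x : C) (y : C), x ⟶ y), ∃ p : Path m.1 m.2.1,
      IsNormalDecomp S m.2.2 p from fun x z g => H ⟨x, z, g⟩
  intro m
  induction m using hRN.induction with
  | h m ih =>
    obtain ⟨x, z, g⟩ := m
    by_cases hg : IsIso g
    · exact ⟨.cons g (.nil z), ⟨trivial, Or.inr hg, trivial⟩, by simp [Path.comp]⟩
    obtain ⟨y, s, hs, ⟨r, rfl⟩, hmax⟩ :=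
      hRN.exists_isHead hC hlcm (fun x => Sharp.of_isIso S (𝟙 x)) hX g
    have hsiso : ¬ IsIso s := fun hsi => by
      obtain ⟨w, a, ha, hai, had⟩ := hgen.exists_lDiv hinv (s ≫ r) hg
      obtain ⟨t, ht⟩ := (hmax a ha had).trans (LDiv.of_isIso s (𝟙 x))
      exact hai (hC.isIso_of_comp_eq_id ht)
    obtain ⟨p, ⟨hgr, hent⟩, hcomp⟩ := ih ⟨y, z, r⟩ ⟨rfl, s, hsiso, by simp⟩
    dsimp only at p hcomp
    refine ⟨.cons s p, ⟨?_, hs, hent⟩, by simp [Path.comp, hcomp]⟩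
    cases p with
    | nil => trivial
    | cons g' p =>
      refine ⟨fun u w f h hh hd => ?_, hgr⟩
      obtain ⟨v, h', hh', hd', hk⟩ :=
        exists_lDiv_comp hC hlcm hgen hX hdiv f h (s ≫ g') (Sharp.of_mem hh) hd
      refine hd'.trans (LDiv.comp_left f (hmax h' hh' (hk.trans ⟨p.comp, ?_⟩)))
      simp [← hcomp, Path.comp]

theorem stmt16 {C : Type u} [Category.{v} C] (hC : LeftCancellative C)
    (hLN : LeftNoetherian C) (hRN : RightNoetherian C)
    (hlcm : ∀ ⦃x y y' : C⦄ (f : x ⟶ y) (g : x ⟶ y'),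
      (∃ (w : C) (h : x ⟶ w), LDiv f h ∧ LDiv g h) →
      ∃ (w : C) (h : x ⟶ w), IsRightLcm f g h)
    (hinv : NoNontrivialInvertible C) :
    IsGarside (fun (x y : C) (g : x ⟶ y) =>
        ∀ S : MorphismProperty C, IsGarside S → S g) ∧
    ∃ T : MorphismProperty C, IsGarside T ∧
      ∀ S : MorphismProperty C, IsGarside S → ∀ ⦃x y : C⦄ (g : x ⟶ y), T g → S g := by
  set T : MorphismProperty C := fun x y g => ∀ S : MorphismProperty C, IsGarside S → S g with hT
  have sharp_T : ∀ {x y : C} (g : x ⟶ y),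
      Sharp T g ↔ ∀ S : MorphismProperty C, IsGarside S → Sharp S g := fun g => by
    rw [hinv.sharp_iff]
    simp only [hinv.sharp_iff, hT]
    by_cases hg : IsIso g <;> simp [hg]
  have hGarside : IsGarside T := by
    refine isGarside_of_closed hC hRN hlcm hinv ?_ ?_ ?_
    · exact generates_of_isAtomMor hLN hRN (fun x y f hf => Or.inr hf)
        fun x y f hf => (sharp_T f).2 fun S hS => hS.sharp_of_isAtomMor hinv hf
    · exact fun x y y' w f g h hf hg hl => (sharp_T h).2 fun S hS =>
        hS.closedUnderRightLcm hC f g h ((sharp_T f).1 hf S hS) ((sharp_T g).1 hg S hS) hl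
    · exact fun x y z f g hfg => (sharp_T g).2 fun S hS =>
        hS.closedUnderRightDivisor hC f g ((sharp_T _).1 hfg S hS)
  exact ⟨hGarside, T, hGarside, fun S hS x y g hg => hg S hS⟩

end GarsideTest
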